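/- Let d ≥ 2, let n, m ≥ 2 be integers with n dividing m, let Γ ≤ SL_d(ℤ) be a countably infinite subgroup, and let S ⊆ Γ be a finite symmetric set with h(G_m, π_m(S)) ≥ ε for some ε > 0. Set δ := ε/(32|S|), let p be the smallest prime divisor of n, and set N := ⌊√(p−1)/25⌋; assume N ≥ 1. Then u ∈ C(α_n × α_m, S, 2), yet every N-step function f: G_n × G_m → {0,1} (i.e., f(x,y) = φ(g(x),h(y)) for some g: G_n → {0,…,N−1}, h: G_m → {0,…,N−1}, φ: N×N → {0,1}) satisfies dist_∞(u, M^{α_n×α_m}_{S,2}[f]) ≥ δ. -/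

import Mathlib

/-- `G_n = SL_d(ℤ/nℤ)`. -/
abbrev SLmod (d n : ℕ) := Matrix.SpecialLinearGroup (Fin d) (ZMod n)

/-- Reduction modulo `n`, as a homomorphism `SL_d(ℤ) → SL_d(ℤ/nℤ)`. -/
def redZ (d n : ℕ) : Matrix.SpecialLinearGroup (Fin d) ℤ →* SLmod d n :=
  Matrix.SpecialLinearGroup.map (Int.castRingHom (ZMod n))

/-- Reduction modulo `n`, as a homomorphism `SL_d(ℤ/mℤ) → SL_d(ℤ/nℤ)`, when `n ∣ m`. -/
def redMod (d : ℕ) {n m : ℕ} (h : n ∣ m) : SLmod d m →* SLmod d n :=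
  Matrix.SpecialLinearGroup.map (ZMod.castHom h (ZMod n))

open Classical in
/-- The invariant map `f_Z : G_n × G_m → {0,1}`, `f_Z(x,y) = 1` iff `π_n(y)⁻¹ x ∈ Z`. -/
noncomputable def fZ (d : ℕ) {n m : ℕ} (hdvd : n ∣ m) (Z : Set (SLmod d n)) :
    SLmod d n × SLmod d m → Fin 2 :=
  fun p => if (redMod d hdvd p.2)⁻¹ * p.1 ∈ Z then 1 else 0

/-- The normalized Hamming distance `dist(f,g) = |{p : f p ≠ g p}| / (|G_n|·|G_m|)`
between maps `G_n × G_m → {0,1}`. -/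
noncomputable def distFn (d n m : ℕ) (f g : SLmod d n × SLmod d m → Fin 2) : ℝ :=
  ({p | f p ≠ g p} : Set (SLmod d n × SLmod d m)).ncard /
    (Nat.card (SLmod d n) * Nat.card (SLmod d m))

/-- The vector `M^{α_n×α_m}_{S,2}[f] ∈ [0,1]^{S×2×2}`, where `α_n × α_m` is the diagonal
action on `G_n × G_m` with the uniform probability measure:  `M[f](γ,i,j)` is the
proportion of points `p ∈ G_n × G_m` with `f p = i` and `f (γ·p) = j`.
(The space `↥S × Fin 2 × Fin 2 → ℝ` carries the sup metric `dist_∞`.) -/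
noncomputable def Mfin (d n m : ℕ) (S : Finset (Matrix.SpecialLinearGroup (Fin d) ℤ))
    (f : SLmod d n × SLmod d m → Fin 2) : ↥S × Fin 2 × Fin 2 → ℝ :=
  fun q => ({p : SLmod d n × SLmod d m | f p = q.2.1 ∧
      f (redZ d n (q.1 : Matrix.SpecialLinearGroup (Fin d) ℤ) * p.1,
         redZ d m (q.1 : Matrix.SpecialLinearGroup (Fin d) ℤ) * p.2) = q.2.2}).ncard /
    (Nat.card (SLmod d n) * Nat.card (SLmod d m))

/-- The vector `u ∈ [0,1]^{S×2×2}` with `u(γ,i,j) = 1/2` if `i = j` and `= 0` otherwise. -/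
noncomputable def uVec {Γ : Type*} (S : Finset Γ) : ↥S × Fin 2 × Fin 2 → ℝ :=
  fun q => if q.2.1 = q.2.2 then 1 / 2 else 0

/-- The boundary `∂(A,S) = {a ∈ A : S·a ⊄ A}` of a set `A` with respect to `S`. -/
def bdry {G : Type*} [Group G] (A S : Set G) : Set G :=
  {a ∈ A | ¬ ∀ s ∈ S, s * a ∈ A}

/-- The Cheeger constant `h(G,S) = min { |∂(A,S)|/|A| : ∅ ≠ A ⊆ G, |A| ≤ |G|/2 }` of a
finite group `G` with respect to `S ⊆ G`. -/
noncomputable def cheeger (G : Type*) [Group G] [Finite G] (S : Set G) : ℝ :=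
  sInf {r : ℝ | ∃ A : Set G, A.Nonempty ∧ 2 * A.ncard ≤ Nat.card G ∧
    r = (bdry A S).ncard / A.ncard}

open Matrix in
theorem transvection_mul_apply_eq {d : ℕ} {R : Type*} [CommRing R] {i j : Fin d} (hij : i ≠ j)
    (c : R) (g : SpecialLinearGroup (Fin d) R) (a b : Fin d) :
    (SpecialLinearGroup.transvection hij c * g) a b =
      if a = i then g i b + c * g j b else g a b := by
  have h : ((SpecialLinearGroup.transvection hij c * g : SpecialLinearGroup (Fin d) R) :
      Matrix (Fin d) (Fin d) R) = Matrix.transvection i j c * (g : Matrix (Fin d) (Fin d) R) := rfl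
  rw [h]
  split_ifs with ha
  · subst ha; simp
  · simp [ha]

/-- The first `k` columns of `g` are those of the identity matrix. -/
def FirstColsStd {d : ℕ} {R : Type*} [CommRing R] (k : ℕ)
    (g : Matrix.SpecialLinearGroup (Fin d) R) : Prop :=
  ∀ i j : Fin d, (j : ℕ) < k → g i j = if i = j then 1 else 0

open Matrix in
theorem FirstColsStd.transvection_mul {d : ℕ} {R : Type*} [CommRing R] {k : ℕ}
    {g : SpecialLinearGroup (Fin d) R} (hg : FirstColsStd k g) {i j : Fin d} (hij : i ≠ j)
    (hj : k ≤ j) (c : R) : FirstColsStd k (SpecialLinearGroup.transvection hij c * g) := by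
  intro a b hb
  rw [transvection_mul_apply_eq]
  split_ifs with h1 h2 h2
  · rw [hg i b hb, hg j b hb, if_pos (h1 ▸ h2), if_neg (by rintro rfl; omega)]; simp
  · rw [hg i b hb, hg j b hb, if_neg (h1 ▸ h2), if_neg (by rintro rfl; omega)]; simp
  · rw [hg a b hb, if_pos h2]
  · rw [hg a b hb, if_neg h2]

open Matrix in
/-- In `SL_d` over a ring, if the first `k` columns of `g` are standard, and `x` divides the entries
of the next column in the rows `≥ k`, then `x` is a unit. -/
theorem FirstColsStd.isUnit_of_dvd {d : ℕ} {R : Type*} [CommRing R] {c : Fin d}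
    {g : SpecialLinearGroup (Fin d) R} (hg : FirstColsStd c g) {x : R}
    (hx : ∀ j, c ≤ j → x ∣ g j c) : IsUnit x := by
  have hmul : ((g⁻¹ : SpecialLinearGroup (Fin d) R) : Matrix (Fin d) (Fin d) R) *
      (g : Matrix (Fin d) (Fin d) R) = 1 :=
    congrArg Subtype.val (inv_mul_cancel g)
  have hinv : ∀ j, j < c → (g⁻¹ : SpecialLinearGroup (Fin d) R) c j = 0 := by
    intro j hj
    have h1 := congrFun (congrFun hmul c) j
    rw [Matrix.one_apply_ne hj.ne', Matrix.mul_apply, Finset.sum_eq_single j] at h1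
    · rwa [hg j j hj, if_pos rfl, mul_one] at h1
    · intro b _ hb
      rw [hg b j hj, if_neg hb, mul_zero]
    · simp
  have h1 := congrFun (congrFun hmul c) c
  rw [Matrix.one_apply_eq, Matrix.mul_apply] at h1
  rw [isUnit_iff_dvd_one, ← h1]
  refine Finset.dvd_sum fun j _ => ?_
  rcases lt_or_ge j c with hj | hj
  · simp [hinv j hj]
  · exact (hx j hj).mul_left _

open Matrix in
theorem exists_firstColsStd_reduction {d n : ℕ} [NeZero n] [Nontrivial (ZMod n)]
    {H : Subgroup (SpecialLinearGroup (Fin d) (ZMod n))}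
    (hH : ∀ (i j : Fin d) (hij : i ≠ j) (c : ZMod n), SpecialLinearGroup.transvection hij c ∈ H)
    {c : Fin d} {g : SpecialLinearGroup (Fin d) (ZMod n)} (hg : FirstColsStd c g) :
    ∃ g' : SpecialLinearGroup (Fin d) (ZMod n),
      FirstColsStd (c + 1) g' ∧ (g' ∈ H → g ∈ H) := by
  set R : Set (SpecialLinearGroup (Fin d) (ZMod n)) :=
    {g' | FirstColsStd c g' ∧ (g' ∈ H → g ∈ H)} with hR
  have step : ∀ g' ∈ R, ∀ (i j : Fin d) (hij : i ≠ j) (_ : c ≤ j) (x : ZMod n),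
      SpecialLinearGroup.transvection hij x * g' ∈ R := by
    intro g' hg' i j hij hj x
    refine ⟨hg'.1.transvection_mul hij hj x, fun h => hg'.2 ?_⟩
    exact (H.mul_mem_cancel_left (hH i j hij x)).1 h
  have hgR : g ∈ R := ⟨hg, id⟩
  -- reach a matrix with a unit in the current column
  obtain ⟨g₁, hg₁, i, hi, hu⟩ : ∃ g' ∈ R, ∃ i, c ≤ i ∧ IsUnit (g' i c) := by
    have hex : ∃ v, ∃ g' ∈ R, ∃ i, c ≤ i ∧ g' i c ≠ 0 ∧ v = (g' i c).val := by
      by_contra hcon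
      push Not at hcon
      have h0 : ∀ j, c ≤ j → g j c = 0 := by
        intro j hj
        by_contra h
        exact hcon _ g hgR j hj h rfl
      have := hg.isUnit_of_dvd (x := 0) (fun j hj => by rw [h0 j hj])
      exact not_isUnit_zero this
    classical
    obtain ⟨g', hg', i, hi, hne, hv⟩ := Nat.find_spec hex
    refine ⟨g', hg', i, hi, hg'.1.isUnit_of_dvd fun j hj => ?_⟩
    by_cases hji : j = i
    · rw [hji]
    set a := g' i c
    set b := g' j c
    have hapos : 0 < a.val := Nat.pos_of_ne_zero (by simpa [ZMod.val_eq_zero] using hne)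
    have hb : b + (-((b.val / a.val : ℕ) : ZMod n)) * a = ((b.val % a.val : ℕ) : ZMod n) := by
      have h1 : ((a.val * (b.val / a.val) + b.val % a.val : ℕ) : ZMod n) = b := by
        rw [Nat.div_add_mod]; simp
      rw [Nat.cast_add, Nat.cast_mul, ZMod.natCast_zmod_val] at h1
      linear_combination -h1
    have hz : b + (-((b.val / a.val : ℕ) : ZMod n)) * a = 0 := by
      by_contra hnz
      have hlt : (b + (-((b.val / a.val : ℕ) : ZMod n)) * a).val < Nat.find hex := by
        rw [hv, hb, ZMod.val_natCast]
        exact (Nat.mod_le _ _).trans_lt (Nat.mod_lt _ hapos)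
      refine Nat.find_min hex hlt ⟨_, step g' hg' j i hji hi (-((b.val / a.val : ℕ) : ZMod n)),
        j, hj, ?_, ?_⟩
      · rw [transvection_mul_apply_eq, if_pos rfl]; exact hnz
      · rw [transvection_mul_apply_eq, if_pos rfl]
    exact ⟨((b.val / a.val : ℕ) : ZMod n), by linear_combination hz⟩
  obtain ⟨u, hu⟩ := hu.exists_right_inv
  -- make the diagonal entry `1`
  obtain ⟨g₂, hg₂, hcc⟩ : ∃ g' ∈ R, g' c c = 1 := by
    by_cases hlast : ∃ c' : Fin d, c < c'
    · obtain ⟨c', hc'⟩ := hlast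
      by_cases hic : i = c
      · subst hic
        have hmem := step g₁ hg₁ c' i hc'.ne' le_rfl ((1 - g₁ c' i) * u)
        refine ⟨_, step _ hmem i c' hc'.ne hc'.le (1 - g₁ i i), ?_⟩
        simp only [transvection_mul_apply_eq, if_pos, if_neg hc'.ne]
        linear_combination (1 - g₁ i i) * (1 - g₁ c' i) * hu
      · refine ⟨_, step g₁ hg₁ c i (Ne.symm hic) hi ((1 - g₁ c c) * u), ?_⟩
        simp only [transvection_mul_apply_eq, if_pos]
        linear_combination (1 - g₁ c c) * hu
    · push Not at hlast
      refine ⟨g, hgR, ?_⟩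
      have hdet := g.det_coe
      rw [Matrix.det_of_isUpperTriangular, Finset.prod_eq_single c] at hdet
      · exact hdet
      · intro b _ hb
        rw [hg b b (lt_of_le_of_ne (hlast b) (Fin.val_ne_of_ne hb)), if_pos rfl]
      · simp
      · intro a b hab
        rw [hg a b (lt_of_lt_of_le hab (hlast a)), if_neg (ne_of_gt (show b < a from hab))]
  -- clear the other entries
  have hclear : ∀ s : Finset (Fin d), c ∉ s →
      ∃ g' ∈ R, g' c c = 1 ∧ ∀ a ∈ s, g' a c = 0 := by
    intro s
    induction s using Finset.induction_on with
    | empty => exact fun _ => ⟨g₂, hg₂, hcc, by simp⟩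
    | insert a s has ih =>
      intro hc
      rw [Finset.mem_insert, not_or] at hc
      obtain ⟨g', hg', h1, h0⟩ := ih hc.2
      refine ⟨_, step g' hg' a c (Ne.symm hc.1) le_rfl (-(g' a c)), ?_, ?_⟩
      · rw [transvection_mul_apply_eq, if_neg hc.1, h1]
      · intro b hb
        rw [transvection_mul_apply_eq]
        split_ifs with hba
        · rw [h1]; ring
        · exact h0 b ((Finset.mem_insert.1 hb).resolve_left hba)
  obtain ⟨g₃, hg₃, h1, h0⟩ := hclear (Finset.univ.erase c) (by simp)
  refine ⟨g₃, fun i j hj => ?_, hg₃.2⟩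
  rcases Nat.lt_succ_iff_lt_or_eq.1 hj with h | h
  · exact hg₃.1 i j h
  · have : j = c := Fin.ext h
    subst this
    split_ifs with hij
    · rw [hij, h1]
    · exact h0 i (by simp [hij])

/-- Transvections generate `SL_d(ℤ/n)`. -/
theorem subgroup_eq_top_of_transvection_mem {d n : ℕ} [NeZero n] [Nontrivial (ZMod n)]
    {H : Subgroup (Matrix.SpecialLinearGroup (Fin d) (ZMod n))}
    (hH : ∀ (i j : Fin d) (hij : i ≠ j) (c : ZMod n),
      Matrix.SpecialLinearGroup.transvection hij c ∈ H) : H = ⊤ := by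
  have key : ∀ l k : ℕ, k + l = d → ∀ g : Matrix.SpecialLinearGroup (Fin d) (ZMod n),
      FirstColsStd k g → g ∈ H := by
    intro l
    induction l with
    | zero =>
      intro k hk g hg
      have : g = 1 := by
        ext i j
        rw [hg i j (by omega), Matrix.SpecialLinearGroup.coe_one, Matrix.one_apply]
      rw [this]; exact H.one_mem
    | succ l ih =>
      intro k hk g hg
      obtain ⟨g', hg', himp⟩ :=
        exists_firstColsStd_reduction hH (c := ⟨k, by omega⟩) (g := g) hg
      exact himp (ih (k + 1) (by omega) g' hg')
  exact (Subgroup.eq_top_iff' H).2 fun g => key d 0 (by simp) g fun i j hj => absurd hj (by simp)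

/-- The diagonal matrix with `u` in position `i`, `u⁻¹` in position `j` and `1` elsewhere. -/
def diagTorus {d : ℕ} {R : Type*} [CommRing R] (i j : Fin d) (u : Rˣ) :
    Matrix.SpecialLinearGroup (Fin d) R :=
  ⟨Matrix.diagonal (Pi.mulSingle i (u : R) * Pi.mulSingle j ((u⁻¹ : Rˣ) : R)), by
    rw [Matrix.det_diagonal]
    simp only [Pi.mul_apply]
    rw [Finset.prod_mul_distrib, Finset.prod_pi_mulSingle', Finset.prod_pi_mulSingle']
    simp⟩

open Matrix in
theorem diagTorus_mul_transvection {d : ℕ} {R : Type*} [CommRing R] {i j : Fin d} (hij : i ≠ j)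
    (u : Rˣ) (t : R) :
    diagTorus i j u * SpecialLinearGroup.transvection hij t =
      SpecialLinearGroup.transvection hij ((u : R) ^ 2 * t) * diagTorus i j u := by
  apply Subtype.ext
  change Matrix.diagonal _ * (1 + Matrix.single i j t) =
    (1 + Matrix.single i j ((u : R) ^ 2 * t)) * Matrix.diagonal _
  rw [mul_add, add_mul, mul_one, one_mul]
  congr 1
  ext a b
  rw [Matrix.diagonal_mul, Matrix.mul_diagonal, Matrix.single_apply, Matrix.single_apply]
  split_ifs with h
  · obtain ⟨rfl, rfl⟩ := h
    simp only [Pi.mul_apply, Pi.mulSingle_eq_same, Pi.mulSingle_eq_of_ne hij,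
      Pi.mulSingle_eq_of_ne hij.symm, mul_one, one_mul]
    rw [pow_two, mul_right_comm, mul_assoc _ _ ((u⁻¹ : Rˣ) : R)]
    simp [mul_comm]
  · simp

theorem diagTorus_neg_one_sq {d : ℕ} {R : Type*} [CommRing R] (i j : Fin d) :
    diagTorus i j (-1 : Rˣ) ^ 2 = 1 := by
  apply Subtype.ext
  rw [pow_two]
  change Matrix.diagonal _ * Matrix.diagonal _ = 1
  rw [Matrix.diagonal_mul_diagonal, ← Matrix.diagonal_one]
  congr 1
  ext a
  simp only [Pi.mul_apply, Pi.mulSingle_apply]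
  split_ifs <;> simp

theorem diagTorus_neg_one_ne_one {d : ℕ} {R : Type*} [CommRing R] {i j : Fin d} (hij : i ≠ j)
    (h : (-1 : R) ≠ 1) : diagTorus i j (-1 : Rˣ) ≠ 1 := by
  intro hcon
  have := congrFun (congrFun (congrArg Subtype.val hcon) i) i
  rw [diagTorus] at this
  simp [hij] at this
  exact h this

/-- The squares of `1, …, (p - 1) / 2`, `p` the smallest prime factor of `n`, have distinct multiples
by any nonzero `k : ZMod n`. -/
theorem mul_sq_injective {n : ℕ} {k : ZMod n} (hk : k ≠ 0) :
    Function.Injective fun s : Fin ((n.minFac - 1) / 2) => k * (((s : ℕ) + 1 : ℕ) : ZMod n) ^ 2 := by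
  have hcop : ∀ r : ℕ, 0 < r → r < n.minFac → IsUnit (r : ZMod n) := by
    intro r h0 hr
    rw [ZMod.isUnit_iff_coprime]
    refine Nat.Coprime.symm (Nat.coprime_of_dvd fun q hq hqn hqr => ?_)
    have h1 := Nat.minFac_le_of_dvd hq.two_le hqn
    have h2 := Nat.le_of_dvd h0 hqr
    omega
  have main : ∀ s t : Fin ((n.minFac - 1) / 2), s < t →
      k * (((s : ℕ) + 1 : ℕ) : ZMod n) ^ 2 ≠ k * (((t : ℕ) + 1 : ℕ) : ZMod n) ^ 2 := by
    intro s t hst h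
    have hs := s.2
    have ht := t.2
    have hst' : (s : ℕ) < t := hst
    have u1 := hcop ((t : ℕ) - s) (by omega) (by omega)
    have u2 := hcop ((t : ℕ) + s + 2) (by omega) (by omega)
    rw [Nat.cast_sub hst'.le] at u1
    push_cast at h u1 u2
    have h0 : k * (((t : ZMod n) - s) * (t + s + 2)) = 0 := by linear_combination -h
    exact hk ((u1.mul u2).mul_left_eq_zero.1 h0)
  intro s t h
  rcases lt_trichotomy s t with h1 | h1 | h1
  · exact absurd h (main s t h1)
  · exact h1
  · exact absurd h.symm (main t s h1)

open Matrix in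
/-- **Quasirandomness of `SL_d(ℤ/n)`**: a nonzero translation-invariant space of functions on
`SL_d(ℤ/n)` without nonzero constants has dimension at least `(p - 1) / 2`, `p` the smallest prime
factor of `n`. -/
theorem exists_linearIndependent_of_translation_invariant {d n : ℕ} (hn : 2 ≤ n) [NeZero n]
    (V : Submodule ℂ (SpecialLinearGroup (Fin d) (ZMod n) → ℂ))
    (hV : ∀ g, ∀ v ∈ V, (fun x => v (g * x)) ∈ V)
    (hconst : ∀ c : ℂ, (fun _ => c) ∈ V → c = 0)
    {v : SpecialLinearGroup (Fin d) (ZMod n) → ℂ} (hv : v ∈ V) (hv0 : v ≠ 0) :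
    ∃ w : Fin ((n.minFac - 1) / 2) → SpecialLinearGroup (Fin d) (ZMod n) → ℂ,
      LinearIndependent ℂ w ∧ ∀ s, w s ∈ V := by
  have : Nontrivial (ZMod n) := by
    have : Fact (1 < n) := ⟨hn⟩
    infer_instance
  -- some transvection group acts nontrivially on `v`
  obtain ⟨i, j, hij, r, y, hr⟩ : ∃ (i j : Fin d) (hij : i ≠ j) (r : ZMod n)
      (y : SpecialLinearGroup (Fin d) (ZMod n)),
      v (SpecialLinearGroup.transvection hij r * y) ≠ v y := by
    by_contra! hcon
    let H : Subgroup (SpecialLinearGroup (Fin d) (ZMod n)) :=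
      { carrier := {g | ∀ x, v (g * x) = v x}
        mul_mem' := fun {a b} ha hb x => by rw [mul_assoc, ha, hb]
        one_mem' := fun x => by rw [one_mul]
        inv_mem' := fun {a} ha x => by rw [← ha (a⁻¹ * x), mul_inv_cancel_left] }
    have htop : H = ⊤ := subgroup_eq_top_of_transvection_mem fun i j hij c => hcon i j hij c
    have hvc : v = fun _ => v 1 := by
      ext x
      have hx : x ∈ H := htop ▸ Subgroup.mem_top x
      rw [← hx 1, mul_one]
    have h1 := hconst (v 1) (hvc ▸ hv)
    exact hv0 (by rw [hvc, h1]; rfl)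
  set U : ZMod n → SpecialLinearGroup (Fin d) (ZMod n) :=
    fun t => SpecialLinearGroup.transvection hij t with hU
  set χ : AddChar (ZMod n) ℂ := ZMod.stdAddChar with hχ
  set P : ZMod n → SpecialLinearGroup (Fin d) (ZMod n) → ℂ :=
    fun k x => ∑ t, χ (-(k * t)) * v (U t * x) with hP
  have hPV : ∀ k, P k ∈ V := by
    intro k
    have : P k = ∑ t, χ (-(k * t)) • fun x => v (U t * x) := by
      ext x; simp [hP]
    rw [this]
    exact V.sum_mem fun t _ => V.smul_mem _ (hV _ _ hv)
  have hPU : ∀ k s x, P k (U s * x) = χ (k * s) * P k x := by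
    intro k s x
    simp only [hP]
    rw [Finset.mul_sum]
    refine Fintype.sum_equiv (Equiv.addRight s) _ _ fun t => ?_
    rw [Equiv.coe_addRight, ← mul_assoc, ← mul_assoc, ← AddChar.map_add_eq_mul]
    simp only [hU, SpecialLinearGroup.transvection_add]
    congr 2
    ring
  obtain ⟨k, hk, x₀, hx₀⟩ : ∃ k, k ≠ 0 ∧ ∃ x, P k x ≠ 0 := by
    by_contra! hcon
    have hsum : ∀ x, (n : ℂ) * v x = P 0 x := by
      intro x
      have h1 : ∑ k, P k x = P 0 x :=
        Finset.sum_eq_single 0 (fun k _ hk => hcon k hk x) (by simp)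
      rw [← h1]
      simp only [hP]
      rw [Finset.sum_comm]
      simp only [← Finset.sum_mul, ← mul_neg]
      rw [Finset.sum_eq_single 0]
      · rw [AddChar.sum_mulShift _ (ZMod.isPrimitive_stdAddChar n)]
        simp [hU, ZMod.card]
      · intro t _ ht
        rw [AddChar.sum_mulShift _ (ZMod.isPrimitive_stdAddChar n)]
        simp [ht]
      · simp
    have h0 : (n : ℂ) ≠ 0 := by exact_mod_cast NeZero.ne n
    refine hr (mul_left_cancel₀ h0 ?_)
    have h2 := hPU 0 r y
    rw [zero_mul, AddChar.map_zero_eq_one, one_mul] at h2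
    rw [hsum, hsum]
    exact h2
  have hunit : ∀ s : Fin ((n.minFac - 1) / 2), IsUnit (((s : ℕ) + 1 : ℕ) : ZMod n) := by
    intro s
    have hs := s.2
    rw [ZMod.isUnit_iff_coprime]
    refine Nat.Coprime.symm (Nat.coprime_of_dvd fun q hq hqn hqr => ?_)
    have h1 := Nat.minFac_le_of_dvd hq.two_le hqn
    have h2 := Nat.le_of_dvd (by omega) hqr
    omega
  choose u hu using hunit
  refine ⟨fun s x => P k (diagTorus i j (u s) * x), ?_, fun s => hV _ _ (hPV k)⟩
  let f : Module.End ℂ (SpecialLinearGroup (Fin d) (ZMod n) → ℂ) :=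
    LinearMap.funLeft ℂ ℂ fun x => U 1 * x
  refine Module.End.eigenvectors_linearIndependent' f
    (fun s : Fin ((n.minFac - 1) / 2) => χ (k * (((s : ℕ) + 1 : ℕ) : ZMod n) ^ 2)) ?_
    (fun s x => P k (diagTorus i j (u s) * x)) ?_
  · exact ZMod.injective_stdAddChar.comp (mul_sq_injective hk)
  · intro s
    rw [Module.End.hasEigenvector_iff, Module.End.mem_eigenspace_iff]
    constructor
    · ext x
      change P k (diagTorus i j (u s) * (U 1 * x)) = _ * P k (diagTorus i j (u s) * x)
      rw [← mul_assoc, diagTorus_mul_transvection, mul_assoc, mul_one, hu]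
      exact hPU _ _ _
    · intro h
      apply hx₀
      have := congrFun h ((diagTorus i j (u s))⁻¹ * x₀)
      simpa using this

open Matrix ComplexOrder in
/-- If the eigenspaces of a positive semidefinite matrix `M` for the nonzero eigenvalues all have
dimension at least `D`, then the quadratic form of `M` is at most `tr M / D`. -/
theorem dotProduct_mulVec_le_trace_of_eigenspace_dim {X : Type*} [Fintype X] [DecidableEq X]
    {M : Matrix X X ℂ} (hM : M.PosSemidef) (D : ℕ)
    (hD : ∀ (μ : ℂ) (v : X → ℂ), μ ≠ 0 → v ≠ 0 → M *ᵥ v = μ • v →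
      ∃ w : Fin D → X → ℂ, LinearIndependent ℂ w ∧ ∀ s, M *ᵥ w s = μ • w s)
    (v : X → ℂ) :
    D * (star v ⬝ᵥ M *ᵥ v).re ≤ M.trace.re * ∑ x, ‖v x‖ ^ 2 := by
  set b := hM.1.eigenvectorBasis with hb
  set l := hM.1.eigenvalues with hl
  have hl0 : ∀ i, 0 ≤ l i := hM.eigenvalues_nonneg
  have htr : M.trace.re = ∑ i, l i := by
    rw [hM.1.trace_eq_sum_eigenvalues]; simp [hl]
  have hsymm := isSymmetric_toEuclideanLin_iff.mpr hM.1
  have hTb : ∀ i, toEuclideanLin M (b i) = (l i : ℂ) • b i := by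
    intro i
    ext x
    have := congrFun (hM.1.mulVec_eigenvectorBasis i) x
    simpa using this
  have hinner : ∀ i (z : EuclideanSpace ℂ X),
      inner ℂ (b i) (toEuclideanLin M z) = (l i : ℂ) * inner ℂ (b i) z := by
    intro i z
    rw [← hsymm, hTb, inner_smul_left]
    simp
  have heig : ∀ i, D * l i ≤ M.trace.re := by
    intro i
    rcases (hl0 i).eq_or_lt with h0 | h0
    · rw [← h0, mul_zero, htr]
      exact Finset.sum_nonneg fun i _ => hl0 i
    have hne : (l i : ℂ) ≠ 0 := by exact_mod_cast h0.ne'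
    obtain ⟨w, hw, hwM⟩ := hD (l i) (b i) hne
      ((WithLp.ofLp_eq_zero 2).ne.2 <| b.orthonormal.ne_zero i)
      (by simpa using hM.1.mulVec_eigenvectorBasis i)
    set J : Finset X := Finset.univ.filter fun x => l x = l i with hJ
    have hcard : D ≤ J.card := by
      let e : (X → ℂ) ≃ₗ[ℂ] EuclideanSpace ℂ X := (WithLp.linearEquiv 2 ℂ (X → ℂ)).symm
      have hw' : LinearIndependent ℂ (e ∘ w) := hw.map' e.toLinearMap e.ker
      have hsub : Submodule.span ℂ (Set.range (e ∘ w)) ≤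
          Submodule.span ℂ ((J.image b : Finset _) : Set (EuclideanSpace ℂ X)) := by
        rw [Submodule.span_le]
        rintro _ ⟨s, rfl⟩
        have hTe : toEuclideanLin M (e (w s)) = (l i : ℂ) • e (w s) := by
          ext x
          have := congrFun (hwM s) x
          simpa [e] using this
        rw [SetLike.mem_coe, Function.comp_apply, ← b.sum_repr (e (w s))]
        refine Submodule.sum_mem _ fun x _ => ?_
        by_cases hx : l x = l i
        · refine Submodule.smul_mem _ _ (Submodule.subset_span ?_)
          exact Finset.mem_coe.2 (Finset.mem_image_of_mem _ (by simp [hJ, hx]))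
        · have h1 := hinner x (e (w s))
          rw [hTe, inner_smul_right] at h1
          have h2 : ((l x : ℂ) - l i) * inner ℂ (b x) (e (w s)) = 0 := by
            linear_combination -h1
          have h3 : (l x : ℂ) - l i ≠ 0 := sub_ne_zero.2 (by exact_mod_cast hx)
          rw [b.repr_apply_apply, (mul_eq_zero.1 h2).resolve_left h3, zero_smul]
          exact Submodule.zero_mem _
      calc D = Module.finrank ℂ (Submodule.span ℂ (Set.range (e ∘ w))) := by
            rw [finrank_span_eq_card hw', Fintype.card_fin]
        _ ≤ Module.finrank ℂ (Submodule.span ℂ ((J.image b : Finset _) :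
              Set (EuclideanSpace ℂ X))) := Submodule.finrank_mono hsub
        _ ≤ (J.image b).card := finrank_span_finset_le_card _
        _ ≤ J.card := Finset.card_image_le
    calc D * l i ≤ J.card * l i := by gcongr
      _ = ∑ x ∈ J, l x := by
        rw [Finset.sum_congr rfl (fun x hx => (Finset.mem_filter.1 hx).2), Finset.sum_const,
          nsmul_eq_mul]
      _ ≤ M.trace.re := by
        rw [htr]
        exact Finset.sum_le_sum_of_subset_of_nonneg (Finset.subset_univ _) fun i _ _ => hl0 i
  set z : EuclideanSpace ℂ X := WithLp.toLp 2 v with hz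
  have h1 : star v ⬝ᵥ M *ᵥ v = inner ℂ z (toEuclideanLin M z) := by
    rw [EuclideanSpace.inner_eq_star_dotProduct]
    simp [hz, dotProduct_comm]
  have h2 : (inner ℂ z (toEuclideanLin M z) : ℂ) = ((∑ i, l i * ‖inner ℂ (b i) z‖ ^ 2 : ℝ) : ℂ) := by
    rw [← b.sum_inner_mul_inner]
    push_cast
    refine Finset.sum_congr rfl fun i _ => ?_
    rw [hinner, ← inner_conj_symm z (b i), ← Complex.conj_mul']
    ring
  have h3 : ∑ x, ‖v x‖ ^ 2 = ∑ i, ‖inner ℂ (b i) z‖ ^ 2 := by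
    rw [b.sum_sq_norm_inner_right, EuclideanSpace.norm_sq_eq]
  rw [h1, h2, h3, Complex.ofReal_re, Finset.mul_sum, Finset.mul_sum]
  refine Finset.sum_le_sum fun i _ => ?_
  rw [← mul_assoc]
  exact mul_le_mul_of_nonneg_right (heig i) (by positivity)

theorem redMod_surjective (d : ℕ) {n m : ℕ} (hn : 2 ≤ n) [NeZero n] (hdvd : n ∣ m) :
    Function.Surjective (redMod d hdvd) := by
  have : Nontrivial (ZMod n) := by
    have : Fact (1 < n) := ⟨hn⟩
    infer_instance
  rw [← MonoidHom.range_eq_top]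
  refine subgroup_eq_top_of_transvection_mem fun i j hij c => ?_
  obtain ⟨c', rfl⟩ := ZMod.castHom_surjective hdvd c
  refine ⟨Matrix.SpecialLinearGroup.transvection hij c', Subtype.ext ?_⟩
  change (Matrix.transvection i j c').map (ZMod.castHom hdvd (ZMod n)) = Matrix.transvection i j _
  rw [Matrix.transvection, Matrix.transvection, Matrix.map_add _ (map_add _), Matrix.map_single,
    Matrix.map_one _ (map_zero _) (map_one _)]

/-- The invariant map `fZ` with its mean subtracted. -/
noncomputable def fZKernel (d : ℕ) {n m : ℕ} (hdvd : n ∣ m) (Z : Set (SLmod d n))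
    (x : SLmod d n) (y : SLmod d m) : ℝ :=
  ((fZ d hdvd Z (x, y) : ℕ) : ℝ) - Z.ncard / Nat.card (SLmod d n)

theorem fZKernel_mul (d : ℕ) {n m : ℕ} (hdvd : n ∣ m) (Z : Set (SLmod d n))
    (g y : SLmod d m) (x : SLmod d n) :
    fZKernel d hdvd Z (redMod d hdvd g * x) (g * y) = fZKernel d hdvd Z x y := by
  have h : (redMod d hdvd (g * y))⁻¹ * (redMod d hdvd g * x) = (redMod d hdvd y)⁻¹ * x := by
    rw [map_mul, mul_inv_rev, mul_assoc, inv_mul_cancel_left]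
  unfold fZKernel fZ
  dsimp only
  rw [h]

theorem sum_fZKernel (d : ℕ) {n m : ℕ} [NeZero n] (hdvd : n ∣ m) (Z : Set (SLmod d n))
    (y : SLmod d m) : ∑ x, fZKernel d hdvd Z x y = 0 := by
  classical
  have h1 : ∑ x, ((fZ d hdvd Z (x, y) : ℕ) : ℝ) = Z.ncard := by
    rw [← Equiv.sum_comp (Equiv.mulLeft (redMod d hdvd y))]
    have : ∀ x, ((fZ d hdvd Z (Equiv.mulLeft (redMod d hdvd y) x, y) : ℕ) : ℝ) =
        if x ∈ Z then 1 else 0 := by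
      intro x
      simp only [fZ, Equiv.coe_mulLeft, inv_mul_cancel_left]
      split_ifs <;> simp
    simp only [this]
    rw [Finset.sum_boole, Set.ncard_eq_toFinset_card']
    congr 2
    ext; simp
  have h2 : (Nat.card (SLmod d n) : ℝ) ≠ 0 := by
    exact_mod_cast Nat.card_pos.ne'
  simp only [fZKernel, Finset.sum_sub_distrib, h1, Finset.sum_const, Finset.card_univ,
    nsmul_eq_mul, ← Nat.card_eq_fintype_card]
  field_simp
  simp

theorem sq_fZKernel_le (d : ℕ) {n m : ℕ} [NeZero n] (hdvd : n ∣ m) (Z : Set (SLmod d n))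
    (x : SLmod d n) (y : SLmod d m) : fZKernel d hdvd Z x y ^ 2 ≤ 1 := by
  have h0 : (0 : ℝ) ≤ Z.ncard / Nat.card (SLmod d n) := by positivity
  have h1 : (Z.ncard : ℝ) / Nat.card (SLmod d n) ≤ 1 := by
    refine div_le_one_of_le₀ ?_ (by positivity)
    exact_mod_cast Set.ncard_le_card Z
  have h2 : (0 : ℝ) ≤ ((fZ d hdvd Z (x, y) : ℕ) : ℝ) := by positivity
  have h3 : ((fZ d hdvd Z (x, y) : ℕ) : ℝ) ≤ 1 := by
    exact_mod_cast Nat.le_of_lt_succ (fZ d hdvd Z (x, y)).2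
  rw [sq_le_one_iff_abs_le_one, abs_le]
  constructor <;> unfold fZKernel <;> linarith

open Matrix ComplexOrder in
/-- **Mixing**: the map `fZ` equidistributes on rectangles, by quasirandomness of `SL_d(ℤ/n)`. -/
theorem fZKernel_mixing (d : ℕ) {n m : ℕ} (hn : 2 ≤ n) [NeZero n] [NeZero m] (hdvd : n ∣ m)
    (Z : Set (SLmod d n)) (A : Finset (SLmod d n)) (B : Finset (SLmod d m)) :
    (((n.minFac - 1) / 2 : ℕ) : ℝ) * (∑ x ∈ A, ∑ y ∈ B, fZKernel d hdvd Z x y) ^ 2 ≤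
      Nat.card (SLmod d n) * Nat.card (SLmod d m) * (A.card * B.card) := by
  classical
  set K : Matrix (SLmod d n) (SLmod d m) ℂ :=
    Matrix.of fun x y => (fZKernel d hdvd Z x y : ℂ) with hK
  have hM : (K * Kᴴ).PosSemidef := posSemidef_self_mul_conjTranspose K
  have hMapp : ∀ x x', (K * Kᴴ) x x' =
      ∑ y, (fZKernel d hdvd Z x y : ℂ) * (fZKernel d hdvd Z x' y : ℂ) := by
    intro x x'
    simp [hK, Matrix.mul_apply]
  have hMinv : ∀ g x x', (K * Kᴴ) (g * x) (g * x') = (K * Kᴴ) x x' := by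
    intro g x x'
    obtain ⟨γ, rfl⟩ := redMod_surjective d hn hdvd g
    rw [hMapp, hMapp, ← Equiv.sum_comp (Equiv.mulLeft γ)]
    simp [fZKernel_mul]
  have hMconst : ∀ c : ℂ, (K * Kᴴ) *ᵥ (fun _ => c) = 0 := by
    intro c
    rw [← Matrix.mulVec_mulVec]
    have : Kᴴ *ᵥ (fun _ => c) = 0 := by
      ext y
      have h := sum_fZKernel d hdvd Z y
      simp only [hK, Matrix.mulVec, dotProduct, conjTranspose_apply, of_apply, ← Finset.sum_mul]
      simp [← Complex.ofReal_sum, h]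
    rw [this, Matrix.mulVec_zero]
  have hD : ∀ (μ : ℂ) (v : SLmod d n → ℂ), μ ≠ 0 → v ≠ 0 → (K * Kᴴ) *ᵥ v = μ • v →
      ∃ w : Fin ((n.minFac - 1) / 2) → SLmod d n → ℂ,
        LinearIndependent ℂ w ∧ ∀ s, (K * Kᴴ) *ᵥ w s = μ • w s := by
    intro μ v hμ hv hvM
    have hV : ∀ g, ∀ u ∈ Module.End.eigenspace (K * Kᴴ).mulVecLin μ,
        (fun x => u (g * x)) ∈ Module.End.eigenspace (K * Kᴴ).mulVecLin μ := by
      intro g u hu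
      rw [Module.End.mem_eigenspace_iff] at hu ⊢
      ext x
      have := congrFun hu (g * x)
      simp only [Matrix.mulVecLin_apply, Matrix.mulVec, dotProduct, Pi.smul_apply] at this ⊢
      rw [← this, ← Equiv.sum_comp (Equiv.mulLeft g) fun x' => (K * Kᴴ) (g * x) x' * u x']
      simp only [Equiv.coe_mulLeft, hMinv]
    have hconst : ∀ c : ℂ, (fun _ => c) ∈ Module.End.eigenspace (K * Kᴴ).mulVecLin μ → c = 0 := by
      intro c hc
      rw [Module.End.mem_eigenspace_iff, Matrix.mulVecLin_apply, hMconst] at hc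
      have := congrFun hc 1
      simpa [hμ] using this.symm
    obtain ⟨w, hw, hwV⟩ := exists_linearIndependent_of_translation_invariant hn
      (Module.End.eigenspace (K * Kᴴ).mulVecLin μ) hV hconst
      (Module.End.mem_eigenspace_iff.2 hvM) hv
    exact ⟨w, hw, fun s => Module.End.mem_eigenspace_iff.1 (hwV s)⟩
  set v : SLmod d n → ℂ := fun x => if x ∈ A then 1 else 0 with hv
  have key := dotProduct_mulVec_le_trace_of_eigenspace_dim hM _ hD v
  set r : SLmod d m → ℝ := fun y => ∑ x ∈ A, fZKernel d hdvd Z x y with hr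
  have hquad : (star v ⬝ᵥ (K * Kᴴ) *ᵥ v).re = ∑ y, r y ^ 2 := by
    have h1 : Kᴴ *ᵥ v = fun y => (r y : ℂ) := by
      ext y
      simp [hK, hv, hr, Matrix.mulVec, dotProduct]
    have h2 : star v ᵥ* K = fun y => (r y : ℂ) := by
      ext y
      simp [hK, hv, hr, Matrix.vecMul, dotProduct, apply_ite]
    rw [← Matrix.mulVec_mulVec, Matrix.dotProduct_mulVec, h1, h2]
    simp only [dotProduct, Complex.re_sum]
    refine Finset.sum_congr rfl fun y _ => ?_
    rw [← Complex.ofReal_mul, Complex.ofReal_re, pow_two]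
  have htrace : (K * Kᴴ).trace.re ≤ Nat.card (SLmod d n) * Nat.card (SLmod d m) := by
    simp only [Matrix.trace, Matrix.diag_apply, hMapp, Complex.re_sum]
    simp only [← Complex.ofReal_mul, Complex.ofReal_re]
    simp only [← pow_two]
    calc ∑ x, ∑ y, fZKernel d hdvd Z x y ^ 2
        ≤ ∑ _x : SLmod d n, ∑ _y : SLmod d m, (1 : ℝ) :=
          Finset.sum_le_sum fun x _ => Finset.sum_le_sum fun y _ => sq_fZKernel_le d hdvd Z x y
      _ = Nat.card (SLmod d n) * Nat.card (SLmod d m) := by simp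
  have hnorm : ∑ x, ‖v x‖ ^ 2 = A.card := by
    have : ∀ x, ‖v x‖ ^ 2 = if x ∈ A then (1 : ℝ) else 0 := by
      intro x; simp only [hv]; split_ifs <;> simp
    simp [this]
  rw [hquad, hnorm] at key
  have hCS : (∑ x ∈ A, ∑ y ∈ B, fZKernel d hdvd Z x y) ^ 2 ≤ B.card * ∑ y, r y ^ 2 := by
    rw [Finset.sum_comm]
    refine sq_sum_le_card_mul_sum_sq.trans ?_
    gcongr
    exact Finset.subset_univ _
  calc _ ≤ (((n.minFac - 1) / 2 : ℕ) : ℝ) * (B.card * ∑ y, r y ^ 2) := by gcongr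
    _ = B.card * ((((n.minFac - 1) / 2 : ℕ) : ℝ) * ∑ y, r y ^ 2) := by ring
    _ ≤ B.card * ((K * Kᴴ).trace.re * A.card) := by gcongr
    _ ≤ B.card * (Nat.card (SLmod d n) * Nat.card (SLmod d m) * A.card) := by gcongr
    _ = _ := by ring

open Classical in
theorem ncard_setOf_eq_sum {X : Type*} [Fintype X] (P : X → Prop) :
    (({x | P x} : Set X).ncard : ℝ) = ∑ x, if P x then (1 : ℝ) else 0 := by
  rw [Finset.sum_boole, Set.ncard_eq_toFinset_card', Set.toFinset_ofPred]

theorem sum_fZ (d : ℕ) {n m : ℕ} [NeZero n] [NeZero m] (hdvd : n ∣ m) (Z : Set (SLmod d n)) :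
    ∑ p : SLmod d n × SLmod d m, ((fZ d hdvd Z p : ℕ) : ℝ) =
      Z.ncard / Nat.card (SLmod d n) * (Nat.card (SLmod d n) * Nat.card (SLmod d m)) := by
  have h : ∑ p : SLmod d n × SLmod d m, (((fZ d hdvd Z p : ℕ) : ℝ) -
      Z.ncard / Nat.card (SLmod d n)) = 0 := by
    rw [Fintype.sum_prod_type_right]
    exact Finset.sum_eq_zero fun y _ => sum_fZKernel d hdvd Z y
  rw [Finset.sum_sub_distrib, sub_eq_zero] at h
  rw [h, Finset.sum_const, Finset.card_univ, Fintype.card_prod, nsmul_eq_mul]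
  push_cast
  rw [Nat.card_eq_fintype_card, Nat.card_eq_fintype_card]
  ring

/-- An `N`-step function is far from `fZ`. -/
theorem le_ncard_ne_fZ_of_step (d : ℕ) {n m : ℕ} (hn : 2 ≤ n) [NeZero n] [NeZero m]
    (hdvd : n ∣ m) (Z : Set (SLmod d n)) {N : ℕ} (g : SLmod d n → Fin N) (h : SLmod d m → Fin N)
    (φ : Fin N × Fin N → Fin 2) {q t : ℝ} (hq : q ≤ Z.ncard / Nat.card (SLmod d n))
    (hq' : q ≤ 1 - Z.ncard / Nat.card (SLmod d n)) (ht : 0 ≤ t)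
    (hD : 0 < (n.minFac - 1) / 2) (hNt : (N : ℝ) ^ 2 ≤ t ^ 2 * (((n.minFac - 1) / 2 : ℕ) : ℝ)) :
    (q - t) * (Nat.card (SLmod d n) * Nat.card (SLmod d m)) ≤
      ({p | φ (g p.1, h p.2) ≠ fZ d hdvd Z p} : Set (SLmod d n × SLmod d m)).ncard := by
  classical
  set a : ℝ := ((Nat.card (SLmod d n) : ℕ) : ℝ) with ha
  set b : ℝ := ((Nat.card (SLmod d m) : ℕ) : ℝ) with hb
  have ha' : a = Fintype.card (SLmod d n) := by rw [ha, Nat.card_eq_fintype_card]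
  have hb' : b = Fintype.card (SLmod d m) := by rw [hb, Nat.card_eq_fintype_card]
  have ha0 : 0 ≤ a := by positivity
  have hb0 : 0 ≤ b := by positivity
  set κ : ℝ := Z.ncard / Nat.card (SLmod d n) with hκ
  set σ : Fin N → Fin N → ℝ := fun i j => if φ (i, j) = 1 then -1 else 1 with hσ
  set A : Fin N → Finset (SLmod d n) := fun i => Finset.univ.filter fun x => g x = i with hA
  set B : Fin N → Finset (SLmod d m) := fun j => Finset.univ.filter fun y => h y = j with hB
  set s : Fin N → Fin N → ℝ := fun i j => ∑ x ∈ A i, ∑ y ∈ B j, fZKernel d hdvd Z x y with hs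
  have hpt : ∀ p : SLmod d n × SLmod d m, q + σ (g p.1) (h p.2) * fZKernel d hdvd Z p.1 p.2 ≤
      if φ (g p.1, h p.2) ≠ fZ d hdvd Z p then (1 : ℝ) else 0 := by
    rintro ⟨x, y⟩
    simp only [hσ, fZKernel]
    rw [← hκ]
    have h01 : ∀ e : Fin 2, e = 0 ∨ e = 1 := by decide
    rcases h01 (φ (g x, h y)) with h1 | h1 <;> rcases h01 (fZ d hdvd Z (x, y)) with h2 | h2 <;>
      simp [h1, h2] <;> linarith
  have hsum : ∑ x, ∑ y, σ (g x) (h y) * fZKernel d hdvd Z x y = ∑ i, ∑ j, σ i j * s i j := by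
    rw [← Finset.sum_fiberwise Finset.univ g]
    refine Finset.sum_congr rfl fun i _ => ?_
    change ∑ x ∈ A i, _ = _
    simp only [hs, Finset.mul_sum]
    rw [Finset.sum_comm (s := Finset.univ) (t := A i)]
    refine Finset.sum_congr rfl fun x hx => ?_
    rw [← Finset.sum_fiberwise Finset.univ h]
    refine Finset.sum_congr rfl fun j _ => Finset.sum_congr rfl fun y hy => ?_
    rw [(Finset.mem_filter.1 hx).2, (Finset.mem_filter.1 hy).2]
  have hcardA : ∑ i, ((A i).card : ℝ) = a := by
    rw [ha', ← Nat.cast_sum, ← Finset.card_univ]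
    congr 1
    exact (Finset.card_eq_sum_card_fiberwise fun _ _ => Finset.mem_coe.2 (Finset.mem_univ _)).symm
  have hcardB : ∑ j, ((B j).card : ℝ) = b := by
    rw [hb', ← Nat.cast_sum, ← Finset.card_univ]
    congr 1
    exact (Finset.card_eq_sum_card_fiberwise fun _ _ => Finset.mem_coe.2 (Finset.mem_univ _)).symm
  set D : ℝ := (((n.minFac - 1) / 2 : ℕ) : ℝ) with hDdef
  have hDpos : 0 < D := Nat.cast_pos.2 hD
  have hCS : (∑ i, ∑ j, |s i j|) ^ 2 ≤ (N : ℝ) ^ 2 * ∑ i, ∑ j, s i j ^ 2 := by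
    have := sq_sum_le_card_mul_sum_sq (s := (Finset.univ : Finset (Fin N × Fin N)))
      (f := fun p => |s p.1 p.2|)
    simpa [Fintype.sum_prod_type, sq_abs, pow_two] using this
  have hsq : D * ∑ i, ∑ j, s i j ^ 2 ≤ (a * b) ^ 2 := by
    calc D * ∑ i, ∑ j, s i j ^ 2 = ∑ i, ∑ j, D * s i j ^ 2 := by simp only [Finset.mul_sum]
      _ ≤ ∑ i, ∑ j, a * b * ((A i).card * (B j).card) :=
        Finset.sum_le_sum fun i _ => Finset.sum_le_sum fun j _ =>
          fZKernel_mixing d hn hdvd Z (A i) (B j)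
      _ = a * b * ((∑ i, ((A i).card : ℝ)) * ∑ j, ((B j).card : ℝ)) := by
        rw [Finset.sum_mul_sum]; simp only [Finset.mul_sum]
      _ = (a * b) ^ 2 := by rw [hcardA, hcardB]; ring
  have habs : ∑ i, ∑ j, |s i j| ≤ t * (a * b) := by
    refine abs_le_of_sq_le_sq' ?_ (by positivity) |>.2
    refine le_of_mul_le_mul_left ?_ hDpos
    calc D * (∑ i, ∑ j, |s i j|) ^ 2 ≤ D * ((N : ℝ) ^ 2 * ∑ i, ∑ j, s i j ^ 2) := by gcongr
      _ = (N : ℝ) ^ 2 * (D * ∑ i, ∑ j, s i j ^ 2) := by ring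
      _ ≤ (t ^ 2 * D) * (a * b) ^ 2 := by gcongr
      _ = D * (t * (a * b)) ^ 2 := by ring
  have hlow : -(t * (a * b)) ≤ ∑ i, ∑ j, σ i j * s i j := by
    have : -∑ i, ∑ j, |s i j| ≤ ∑ i, ∑ j, σ i j * s i j := by
      simp only [← Finset.sum_neg_distrib]
      refine Finset.sum_le_sum fun i _ => Finset.sum_le_sum fun j _ => ?_
      have h1 := neg_abs_le (s i j)
      have h2 := le_abs_self (s i j)
      simp only [hσ]
      split_ifs <;> linarith
    linarith
  rw [ncard_setOf_eq_sum]
  calc (q - t) * (a * b) ≤ q * (a * b) + ∑ i, ∑ j, σ i j * s i j := by linarith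
    _ = ∑ p : SLmod d n × SLmod d m,
        (q + σ (g p.1) (h p.2) * fZKernel d hdvd Z p.1 p.2) := by
      rw [Finset.sum_add_distrib, Finset.sum_const, Finset.card_univ, Fintype.card_prod,
        nsmul_eq_mul, ← hsum, Fintype.sum_prod_type, ha', hb']
      push_cast
      ring
    _ ≤ ∑ p, if φ (g p.1, h p.2) ≠ fZ d hdvd Z p then (1 : ℝ) else 0 :=
      Finset.sum_le_sum fun p _ => hpt p
    _ = _ := Finset.sum_congr rfl fun p _ => by congr

theorem redMod_redZ (d : ℕ) {n m : ℕ} (hdvd : n ∣ m) (γ : Matrix.SpecialLinearGroup (Fin d) ℤ) :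
    redMod d hdvd (redZ d m γ) = redZ d n γ := by
  apply Subtype.ext
  ext i j
  change ZMod.castHom hdvd (ZMod n) ((γ.1 i j : ℤ) : ZMod m) = ((γ.1 i j : ℤ) : ZMod n)
  simp

theorem fZ_invariant (d : ℕ) {n m : ℕ} (hdvd : n ∣ m) (Z : Set (SLmod d n))
    (γ : Matrix.SpecialLinearGroup (Fin d) ℤ) (p : SLmod d n × SLmod d m) :
    fZ d hdvd Z (redZ d n γ * p.1, redZ d m γ * p.2) = fZ d hdvd Z p := by
  have h : (redMod d hdvd (redZ d m γ * p.2))⁻¹ * (redZ d n γ * p.1) =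
      (redMod d hdvd p.2)⁻¹ * p.1 := by
    rw [map_mul, redMod_redZ, mul_inv_rev, mul_assoc, inv_mul_cancel_left]
  unfold fZ
  dsimp only
  rw [h]

/-- Almost invariant functions on `G_n × G_m` are close to an invariant one. -/
theorem exists_fZ_close (d : ℕ) {n m : ℕ} [NeZero n] [NeZero m] (hdvd : n ∣ m)
    (S : Finset (Matrix.SpecialLinearGroup (Fin d) ℤ)) {ε : ℝ}
    (hch : ∀ B : Set (SLmod d m), 2 * B.ncard ≤ Nat.card (SLmod d m) →
      ε * B.ncard ≤ (bdry B (⇑(redZ d m) '' ↑S)).ncard)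
    (f : SLmod d n × SLmod d m → Fin 2) :
    ∃ Z : Set (SLmod d n),
      ε * ({p | f p ≠ fZ d hdvd Z p} : Set (SLmod d n × SLmod d m)).ncard ≤
      ∑ γ ∈ S, (({p | f p ≠ f (redZ d n γ * p.1, redZ d m γ * p.2)} :
        Set (SLmod d n × SLmod d m)).ncard : ℝ) := by
  classical
  let e : SLmod d n × SLmod d m ≃ SLmod d n × SLmod d m :=
    { toFun := fun p => (redMod d hdvd p.2 * p.1, p.2)
      invFun := fun p => ((redMod d hdvd p.2)⁻¹ * p.1, p.2)
      left_inv := fun p => by simp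
      right_inv := fun p => by simp }
  have he : ∀ z y, e (z, y) = (redMod d hdvd y * z, y) := fun _ _ => rfl
  have heγ : ∀ γ z y, (redZ d n γ * (e (z, y)).1, redZ d m γ * (e (z, y)).2) =
      e (z, redZ d m γ * y) := by
    intro γ z y
    simp only [he]
    rw [map_mul, redMod_redZ, mul_assoc]
  set Z : Set (SLmod d n) :=
    {z | Nat.card (SLmod d m) < 2 * ({y | f (e (z, y)) = 1} : Set (SLmod d m)).ncard} with hZ
  refine ⟨Z, ?_⟩
  have hfZe : ∀ z y, fZ d hdvd Z (e (z, y)) = if z ∈ Z then 1 else 0 := by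
    intro z y
    have h : (redMod d hdvd y)⁻¹ * (redMod d hdvd y * z) = z := inv_mul_cancel_left _ _
    rw [he]
    unfold fZ
    dsimp only
    rw [h]
    congr
  set W : SLmod d n → Set (SLmod d m) :=
    fun z => {y | f (e (z, y)) ≠ fZ d hdvd Z (e (z, y))} with hW
  have hWcard : ∀ z, 2 * (W z).ncard ≤ Nat.card (SLmod d m) := by
    intro z
    have h01 : ∀ c : Fin 2, c ≠ 1 ↔ c = 0 := by decide
    have h10 : ∀ c : Fin 2, c ≠ 0 ↔ c = 1 := by decide
    by_cases hz : z ∈ Z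
    · have hWz : W z = ({y | f (e (z, y)) = 1} : Set (SLmod d m))ᶜ := by
        ext y; simp [hW, hfZe, hz]
      have h1 := Set.ncard_add_ncard_compl ({y | f (e (z, y)) = 1} : Set (SLmod d m))
      have h2 : Nat.card (SLmod d m) < 2 * ({y | f (e (z, y)) = 1} : Set (SLmod d m)).ncard := hz
      rw [hWz]
      omega
    · have hWz : W z = ({y | f (e (z, y)) = 1} : Set (SLmod d m)) := by
        ext y; simp only [hW, hfZe, hz, if_false, Set.mem_ofPred_eq, h10]
      rw [hWz]
      exact not_lt.1 hz
  have hbdry : ∀ z, ((bdry (W z) (⇑(redZ d m) '' ↑S)).ncard : ℝ) ≤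
      ∑ γ ∈ S, ∑ y, if f (e (z, y)) ≠ f (e (z, redZ d m γ * y)) then (1 : ℝ) else 0 := by
    intro z
    have hsub : bdry (W z) (⇑(redZ d m) '' ↑S) ⊆
        ⋃ γ ∈ S, {y | f (e (z, y)) ≠ f (e (z, redZ d m γ * y))} := by
      rintro y ⟨hy, hns⟩
      push Not at hns
      obtain ⟨_, ⟨γ, hγ, rfl⟩, hnot⟩ := hns
      simp only [Set.mem_iUnion]
      refine ⟨γ, hγ, fun heq => hnot ?_⟩
      simp only [hW, hfZe, Set.mem_ofPred_eq] at hy ⊢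
      rwa [← heq]
    have h1 := (Set.ncard_le_ncard hsub (Set.toFinite _)).trans
      (Finset.set_ncard_biUnion_le S
        fun γ => {y | f (e (z, y)) ≠ f (e (z, redZ d m γ * y))})
    calc ((bdry (W z) (⇑(redZ d m) '' ↑S)).ncard : ℝ)
        ≤ ((∑ γ ∈ S, ({y | f (e (z, y)) ≠ f (e (z, redZ d m γ * y))} :
            Set (SLmod d m)).ncard : ℕ) : ℝ) := by exact_mod_cast h1
      _ = _ := by
        push_cast
        refine Finset.sum_congr rfl fun γ _ => ?_
        rw [ncard_setOf_eq_sum]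
        exact Finset.sum_congr rfl fun p _ => by congr
  have hT : (({p | f p ≠ fZ d hdvd Z p} : Set (SLmod d n × SLmod d m)).ncard : ℝ) =
      ∑ z, ((W z).ncard : ℝ) := by
    rw [ncard_setOf_eq_sum, ← Equiv.sum_comp e, Fintype.sum_prod_type]
    refine Finset.sum_congr rfl fun z _ => ?_
    rw [hW, ncard_setOf_eq_sum]
  have hR : ∀ γ, (({p | f p ≠ f (redZ d n γ * p.1, redZ d m γ * p.2)} :
      Set (SLmod d n × SLmod d m)).ncard : ℝ) =
      ∑ z, ∑ y, if f (e (z, y)) ≠ f (e (z, redZ d m γ * y)) then (1 : ℝ) else 0 := by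
    intro γ
    rw [ncard_setOf_eq_sum, ← Equiv.sum_comp e, Fintype.sum_prod_type]
    refine Finset.sum_congr rfl fun z _ => Finset.sum_congr rfl fun y _ => ?_
    rw [heγ]
    congr
  simp only [hR]
  rw [hT, Finset.mul_sum, Finset.sum_comm]
  exact Finset.sum_le_sum fun z _ => (hch _ (hWcard z)).trans (hbdry z)

theorem cheeger_mul_ncard_le {G : Type*} [Group G] [Finite G] {S : Set G} {ε : ℝ}
    (hε : ε ≤ cheeger G S) {B : Set G} (hB : 2 * B.ncard ≤ Nat.card G) :
    ε * B.ncard ≤ (bdry B S).ncard := by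
  rcases B.eq_empty_or_nonempty with rfl | hne
  · simp
  · have hpos : (0 : ℝ) < B.ncard := by exact_mod_cast (Set.ncard_pos (Set.toFinite _)).2 hne
    rw [← le_div_iff₀ hpos]
    refine hε.trans (csInf_le ⟨0, ?_⟩ ⟨B, hne, hB, rfl⟩)
    rintro _ ⟨A, -, -, rfl⟩
    positivity

theorem le_one_and_nonempty_of_le_cheeger {G : Type*} [Group G] [Finite G] {S : Set G} {ε : ℝ}
    (h0 : 0 < ε) (hε : ε ≤ cheeger G S) : ε ≤ 1 ∧ S.Nonempty := by
  obtain ⟨_, B, hne, hB, -⟩ : {r : ℝ | ∃ A : Set G, A.Nonempty ∧ 2 * A.ncard ≤ Nat.card G ∧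
      r = (bdry A S).ncard / A.ncard}.Nonempty := by
    by_contra h
    rw [Set.not_nonempty_iff_eq_empty] at h
    rw [cheeger, h, Real.sInf_empty] at hε
    linarith
  have hpos : (0 : ℝ) < B.ncard := by exact_mod_cast (Set.ncard_pos (Set.toFinite _)).2 hne
  have h1 := cheeger_mul_ncard_le hε hB
  constructor
  · have h2 : ((bdry B S).ncard : ℝ) ≤ B.ncard := by
      exact_mod_cast Set.ncard_le_ncard (show bdry B S ⊆ B from fun x hx => hx.1) (Set.toFinite _)
    nlinarith
  · by_contra hS
    rw [Set.not_nonempty_iff_eq_empty] at hS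
    have : bdry B S = ∅ := by
      ext x; simp [bdry, hS]
    rw [this, Set.ncard_empty, Nat.cast_zero] at h1
    nlinarith

theorem exists_set_two_mul_ncard_eq {G : Type*} [Group G] [Finite G] {g : G} (h2 : g ^ 2 = 1)
    (h1 : g ≠ 1) : ∃ Z : Set G, 2 * Z.ncard = Nat.card G := by
  classical
  have := Fintype.ofFinite G
  have hord : orderOf g = 2 := orderOf_eq_prime h2 h1
  obtain ⟨k, hk⟩ := hord ▸ orderOf_dvd_natCard g
  obtain ⟨Z, -, hZ⟩ := Finset.exists_subset_card_eq
    (show k ≤ (Finset.univ : Finset G).card by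
      rw [Finset.card_univ, ← Nat.card_eq_fintype_card, hk]; omega)
  exact ⟨Z, by rw [Set.ncard_coe_finset, hZ, hk]⟩

theorem Mfin_fZ_eq_uVec (d : ℕ) {n m : ℕ} [NeZero n] [NeZero m] (hdvd : n ∣ m)
    (S : Finset (Matrix.SpecialLinearGroup (Fin d) ℤ)) {Z : Set (SLmod d n)}
    (hZ : 2 * Z.ncard = Nat.card (SLmod d n)) :
    Mfin d n m S (fZ d hdvd Z) = uVec S := by
  have ha : (0 : ℝ) < Nat.card (SLmod d n) := by exact_mod_cast Nat.card_pos
  have hb : (0 : ℝ) < Nat.card (SLmod d m) := by exact_mod_cast Nat.card_pos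
  have hκ : (Z.ncard : ℝ) / Nat.card (SLmod d n) = 1 / 2 := by
    rw [div_eq_iff ha.ne', ← hZ]
    push_cast
    ring
  have hone : (({p | fZ d hdvd Z p = 1} : Set (SLmod d n × SLmod d m)).ncard : ℝ) =
      1 / 2 * (Nat.card (SLmod d n) * Nat.card (SLmod d m)) := by
    rw [← hκ, ← sum_fZ d hdvd, ncard_setOf_eq_sum]
    refine Finset.sum_congr rfl fun p _ => ?_
    generalize fZ d hdvd Z p = c
    fin_cases c <;> simp
  have hzero : (({p | fZ d hdvd Z p = 0} : Set (SLmod d n × SLmod d m)).ncard : ℝ) =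
      1 / 2 * (Nat.card (SLmod d n) * Nat.card (SLmod d m)) := by
    have h10 : ∀ c : Fin 2, c = 0 ↔ ¬ c = 1 := by decide
    have hc : ({p | fZ d hdvd Z p = 0} : Set (SLmod d n × SLmod d m)) =
        ({p | fZ d hdvd Z p = 1})ᶜ := by
      ext p
      exact h10 _
    have h1 := Set.ncard_add_ncard_compl ({p | fZ d hdvd Z p = 1} : Set (SLmod d n × SLmod d m))
    rw [Nat.card_prod] at h1
    have h2 : ((({p | fZ d hdvd Z p = 1} : Set (SLmod d n × SLmod d m)).ncard : ℝ) +
        (({p | fZ d hdvd Z p = 1} : Set (SLmod d n × SLmod d m))ᶜ).ncard) =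
        Nat.card (SLmod d n) * Nat.card (SLmod d m) := by exact_mod_cast h1
    rw [hc]
    linarith
  funext ⟨γ, i, j⟩
  simp only [Mfin, uVec, fZ_invariant]
  split_ifs with hij
  · subst hij
    simp only [and_self]
    rw [div_eq_iff (by positivity)]
    fin_cases i
    · exact hzero
    · exact hone
  · have : ({p | fZ d hdvd Z p = i ∧ fZ d hdvd Z p = j} : Set (SLmod d n × SLmod d m)) = ∅ := by
      ext p
      simp only [Set.mem_ofPred_eq, Set.mem_empty_iff_false, iff_false]
      rintro ⟨rfl, h⟩
      exact hij h
    rw [this]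
    simp

/-- If `M[f]` is close to `u`, then `f` is almost invariant and nearly balanced. -/
theorem ncard_bounds_of_dist_lt (d : ℕ) {n m : ℕ} [NeZero n] [NeZero m]
    {S : Finset (Matrix.SpecialLinearGroup (Fin d) ℤ)} {f : SLmod d n × SLmod d m → Fin 2} {δ : ℝ}
    (hδ : dist (uVec S) (Mfin d n m S f) < δ) {γ : Matrix.SpecialLinearGroup (Fin d) ℤ}
    (hγ : γ ∈ S) :
    (({p | f p ≠ f (redZ d n γ * p.1, redZ d m γ * p.2)} :
        Set (SLmod d n × SLmod d m)).ncard : ℝ) ≤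
      2 * δ * (Nat.card (SLmod d n) * Nat.card (SLmod d m)) ∧
    ∀ i, (1 / 2 - δ) * (Nat.card (SLmod d n) * Nat.card (SLmod d m)) ≤
      (({p | f p = i} : Set (SLmod d n × SLmod d m)).ncard : ℝ) := by
  have ha : (0 : ℝ) < Nat.card (SLmod d n) := by exact_mod_cast Nat.card_pos
  have hb : (0 : ℝ) < Nat.card (SLmod d m) := by exact_mod_cast Nat.card_pos
  have hab := mul_pos ha hb
  set R : Fin 2 → Fin 2 → Set (SLmod d n × SLmod d m) := fun i j =>
    {p | f p = i ∧ f (redZ d n γ * p.1, redZ d m γ * p.2) = j} with hR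
  have key : ∀ i j, |(if i = j then (1 / 2 : ℝ) else 0) -
      (R i j).ncard / (Nat.card (SLmod d n) * Nat.card (SLmod d m))| < δ := fun i j =>
    (dist_le_pi_dist (uVec S) (Mfin d n m S f) (⟨γ, hγ⟩, i, j)).trans_lt hδ
  constructor
  · have hoff : ∀ i j, i ≠ j →
        ((R i j).ncard : ℝ) ≤ δ * (Nat.card (SLmod d n) * Nat.card (SLmod d m)) := by
      intro i j hij
      have := (abs_lt.1 (key i j)).1
      rw [if_neg hij] at this
      rw [← div_le_iff₀ hab]
      linarith
    have hsub : ({p | f p ≠ f (redZ d n γ * p.1, redZ d m γ * p.2)} :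
        Set (SLmod d n × SLmod d m)) ⊆ R 0 1 ∪ R 1 0 := by
      have h01 : ∀ a b : Fin 2, a ≠ b → (a = 0 ∧ b = 1) ∨ (a = 1 ∧ b = 0) := by decide
      exact fun p hp => h01 _ _ hp
    have hle : (({p | f p ≠ f (redZ d n γ * p.1, redZ d m γ * p.2)} :
        Set (SLmod d n × SLmod d m)).ncard : ℝ) ≤ (R 0 1).ncard + (R 1 0).ncard := by
      exact_mod_cast (Set.ncard_le_ncard hsub (Set.toFinite _)).trans (Set.ncard_union_le _ _)
    have h1 := hoff 0 1 (by decide)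
    have h2 := hoff 1 0 (by decide)
    linarith
  · intro i
    have h1 := (abs_lt.1 (key i i)).2
    rw [if_pos rfl] at h1
    have h2 : ((R i i).ncard : ℝ) ≤ (({p | f p = i} : Set (SLmod d n × SLmod d m)).ncard : ℝ) := by
      exact_mod_cast Set.ncard_le_ncard (show R i i ⊆ {p | f p = i} from fun p hp => hp.1)
        (Set.toFinite _)
    refine le_trans ?_ h2
    rw [← le_div_iff₀ hab]
    linarith

theorem abs_sum_sub_le_ncard_ne {X : Type*} [Fintype X] (f g : X → Fin 2) :
    |(({x | f x = 1} : Set X).ncard : ℝ) - ∑ x, ((g x : ℕ) : ℝ)| ≤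
      (({x | f x ≠ g x} : Set X).ncard : ℝ) := by
  classical
  rw [ncard_setOf_eq_sum, ncard_setOf_eq_sum, ← Finset.sum_sub_distrib]
  refine (Finset.abs_sum_le_sum_abs _ _).trans (Finset.sum_le_sum fun x _ => ?_)
  generalize f x = a
  generalize g x = b
  fin_cases a <;> fin_cases b <;> simp

theorem mul_two_mul_div_eq {s : ℝ} (hs : s ≠ 0) (ε c : ℝ) :
    s * (2 * (ε / (32 * s)) * c) = ε * (c / 16) := by
  field_simp
  ring

/-- If `S` has Cheeger constant at least `ε`, then `M[f]` is far from `u` for step functions `f`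
with few steps. -/
theorem le_dist_uVec_Mfin_of_step (d : ℕ) {n m : ℕ} (hn : 2 ≤ n) [NeZero n] [NeZero m]
    (hdvd : n ∣ m) (S : Finset (Matrix.SpecialLinearGroup (Fin d) ℤ)) {ε : ℝ} (hε : 0 < ε)
    (hcheeger : ε ≤ cheeger (SLmod d m) (⇑(redZ d m) '' ↑S)) {N : ℕ}
    (hD : 0 < (n.minFac - 1) / 2)
    (hNt : (N : ℝ) ^ 2 ≤ (2 / 25) ^ 2 * (((n.minFac - 1) / 2 : ℕ) : ℝ))
    {f : SLmod d n × SLmod d m → Fin 2} (g : SLmod d n → Fin N) (h : SLmod d m → Fin N)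
    (φ : Fin N × Fin N → Fin 2) (hf : ∀ p, f p = φ (g p.1, h p.2)) :
    ε / (32 * S.card) ≤ dist (uVec S) (Mfin d n m S f) := by
  by_contra! hlt
  obtain ⟨hε1, hSne⟩ := le_one_and_nonempty_of_le_cheeger hε hcheeger
  obtain ⟨γ, hγ⟩ : S.Nonempty := by simpa using hSne
  have hScard : (1 : ℝ) ≤ S.card := by exact_mod_cast Finset.card_pos.2 ⟨γ, hγ⟩
  have hδ : ε / (32 * S.card) ≤ 1 / 32 := by
    rw [div_le_iff₀ (by linarith)]
    linarith
  obtain ⟨Z, hZ⟩ := exists_fZ_close d hdvd S (fun B hB => cheeger_mul_ncard_le hcheeger hB) f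
  have ha : (0 : ℝ) < Nat.card (SLmod d n) := by exact_mod_cast Nat.card_pos
  have hb : (0 : ℝ) < Nat.card (SLmod d m) := by exact_mod_cast Nat.card_pos
  have hstep := le_ncard_ne_fZ_of_step d hn hdvd Z g h φ (q := 13 / 32) (t := 2 / 25)
  have hfun : f = fun p => φ (g p.1, h p.2) := funext hf
  have hfset : ({p | φ (g p.1, h p.2) ≠ fZ d hdvd Z p} : Set (SLmod d n × SLmod d m)) =
      {p | f p ≠ fZ d hdvd Z p} := by rw [hfun]
  rw [hfset] at hstep
  have hdens := abs_le.1 (abs_sum_sub_le_ncard_ne f (fZ d hdvd Z))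
  rw [sum_fZ] at hdens
  set T : ℝ := (({p | f p ≠ fZ d hdvd Z p} : Set (SLmod d n × SLmod d m)).ncard : ℝ) with hTdef
  set κ : ℝ := Z.ncard / Nat.card (SLmod d n) with hκ
  set c : ℝ := (Nat.card (SLmod d n) : ℝ) * Nat.card (SLmod d m) with hc
  have hc0 : 0 < c := mul_pos ha hb
  have hT : T ≤ c / 16 := by
    have h1 := hZ.trans (Finset.sum_le_sum fun γ hγ => (ncard_bounds_of_dist_lt d hlt hγ).1)
    rw [Finset.sum_const, nsmul_eq_mul] at h1
    have h2 : (S.card : ℝ) * (2 * (ε / (32 * S.card)) * c) = ε * (c / 16) := by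
      exact mul_two_mul_div_eq (zero_lt_one.trans_le hScard).ne' ε c
    rw [← hc, h2] at h1
    exact le_of_mul_le_mul_left h1 hε
  have hone := (ncard_bounds_of_dist_lt d hlt hγ).2 1
  have hzero := (ncard_bounds_of_dist_lt d hlt hγ).2 0
  rw [← hc] at hone hzero
  have hcompl : (({p | f p = 1} : Set (SLmod d n × SLmod d m)).ncard : ℝ) +
      (({p | f p = 0} : Set (SLmod d n × SLmod d m)).ncard : ℝ) = c := by
    have h10 : ∀ e : Fin 2, e = 0 ↔ ¬ e = 1 := by decide
    have hset : ({p | f p = 0} : Set (SLmod d n × SLmod d m)) = ({p | f p = 1})ᶜ := by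
      ext p
      exact h10 _
    have h1 := Set.ncard_add_ncard_compl ({p | f p = 1} : Set (SLmod d n × SLmod d m))
    rw [Nat.card_prod] at h1
    rw [hset, hc]
    exact_mod_cast h1
  have hδc : 15 / 32 * c ≤ (1 / 2 - ε / (32 * S.card)) * c :=
    mul_le_mul_of_nonneg_right (by linarith) hc0.le
  have hlow : 13 / 32 ≤ κ := by
    refine le_of_mul_le_mul_right ?_ hc0
    linarith [hdens.2]
  have hhigh : 13 / 32 ≤ 1 - κ := by
    refine le_of_mul_le_mul_right ?_ hc0
    linarith [hdens.1]
  have := hstep hlow hhigh (by norm_num) hD hNt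
  linarith

/-- Lemma 5.5 (main lemma, finite version): with `S ⊆ Γ` finite symmetric,
`h(G_m, π_m(S)) ≥ ε`, `δ = ε/(32|S|)`, `p` the smallest prime divisor of `n`, and
`N = ⌊√(p−1)/25⌋ ≥ 1`: the vector `u` lies in `C(α_n × α_m, S, 2)` (the closure of the
set of all vectors `M^{α_n×α_m}_{S,2}[f]`), yet every `N`-step function
`f : G_n × G_m → {0,1}` satisfies `dist_∞(u, M^{α_n×α_m}_{S,2}[f]) ≥ δ`. -/
theorem main_lemma_finite (d n m : ℕ) (hd : 2 ≤ d) (hn : 2 ≤ n) (hm : 2 ≤ m)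
    (hdvd : n ∣ m) [NeZero n] [NeZero m]
    (Γ : Subgroup (Matrix.SpecialLinearGroup (Fin d) ℤ)) (hinf : Infinite ↥Γ)
    (S : Finset (Matrix.SpecialLinearGroup (Fin d) ℤ))
    (hSsub : ↑S ⊆ (Γ : Set (Matrix.SpecialLinearGroup (Fin d) ℤ)))
    (hSsymm : ∀ γ ∈ S, γ⁻¹ ∈ S)
    (ε : ℝ) (hε : 0 < ε)
    (hcheeger : ε ≤ cheeger (SLmod d m) (⇑(redZ d m) '' ↑S))
    (N : ℕ) (hN : N = Nat.floor (Real.sqrt ((n.minFac : ℝ) - 1) / 25)) (hN1 : 1 ≤ N) :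
    uVec S ∈ closure {v | ∃ f : SLmod d n × SLmod d m → Fin 2, Mfin d n m S f = v} ∧
    ∀ f : SLmod d n × SLmod d m → Fin 2,
      (∃ (g : SLmod d n → Fin N) (h : SLmod d m → Fin N)
          (φ : Fin N × Fin N → Fin 2), ∀ p, f p = φ (g p.1, h p.2)) →
      ε / (32 * S.card) ≤ dist (uVec S) (Mfin d n m S f) := by
  have hn0 : n ≠ 1 := by omega
  have hprime : n.minFac.Prime := Nat.minFac_prime hn0
  have hp1 : (1 : ℝ) ≤ n.minFac := by exact_mod_cast hprime.one_le
  have hNle : (N : ℝ) ≤ Real.sqrt ((n.minFac : ℝ) - 1) / 25 := by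
    rw [hN]
    exact Nat.floor_le (by positivity)
  have hN1' : (1 : ℝ) ≤ N := by exact_mod_cast hN1
  have hNsq : 625 * (N : ℝ) ^ 2 ≤ (n.minFac : ℝ) - 1 := by
    have h1 : 25 * (N : ℝ) ≤ Real.sqrt ((n.minFac : ℝ) - 1) := by linarith
    have h2 := Real.le_sqrt' (by linarith : 0 < 25 * (N : ℝ)) |>.1 h1
    nlinarith
  have hp626 : 626 ≤ n.minFac := by
    have : (626 : ℝ) ≤ n.minFac := by nlinarith
    exact_mod_cast this
  have hn626 : 626 ≤ n := hp626.trans (Nat.minFac_le (by omega))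
  constructor
  · have : Fact (2 < n) := ⟨by omega⟩
    have hij : (⟨0, by omega⟩ : Fin d) ≠ ⟨1, by omega⟩ := by simp
    obtain ⟨Z, hZ⟩ := exists_set_two_mul_ncard_eq (diagTorus_neg_one_sq _ _)
      (diagTorus_neg_one_ne_one hij (ZMod.neg_one_ne_one (n := n)))
    exact subset_closure ⟨fZ d hdvd Z, Mfin_fZ_eq_uVec d hdvd S hZ⟩
  · rintro f ⟨g, h, φ, hf⟩
    have hdiv : n.minFac - 1 ≤ 4 * ((n.minFac - 1) / 2) := by omega
    have hdiv' : (n.minFac : ℝ) - 1 ≤ 4 * (((n.minFac - 1) / 2 : ℕ) : ℝ) := by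
      have : ((n.minFac - 1 : ℕ) : ℝ) ≤ 4 * (((n.minFac - 1) / 2 : ℕ) : ℝ) := by
        exact_mod_cast hdiv
      rwa [Nat.cast_sub hprime.one_le, Nat.cast_one] at this
    exact le_dist_uVec_Mfin_of_step d hn hdvd S hε hcheeger (by omega) (by linarith) g h φ hf
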